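/- Let α > 0, c₂ > 0, a > 0, and let C(χ) := 1 − c₂|χ|² (exact quadratic covariance model). Then the effective scattering kernel admits the closed form: e^{−α} · (1/(2π)) ∫_{ℝ²} e^{−|s|²/2} [ exp( α ∫₀¹ C(a s s') ds' ) − 1 ] ds = 1/(1 + 2 α c₂ a²/3) − e^{−α}. -/

import Mathlib

open MeasureTheory

lemma integral_exp_neg_mul_sq_norm_plane {b : ℝ} (hb : 0 < b) :
    ∫ s : EuclideanSpace ℝ (Fin 2), Real.exp (-b * ‖s‖ ^ 2) = Real.pi / b := by
  rw [GaussianFourier.integral_rexp_neg_mul_sq_norm hb]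
  simp

lemma integrable_exp_neg_mul_sq_norm_plane {b : ℝ} (hb : 0 < b) :
    Integrable fun s : EuclideanSpace ℝ (Fin 2) => Real.exp (-b * ‖s‖ ^ 2) := by
  refine Integrable.of_integral_ne_zero ?_
  rw [integral_exp_neg_mul_sq_norm_plane hb]
  positivity

lemma integral_quadratic_along_ray {E : Type*} [NormedAddCommGroup E] [NormedSpace ℝ E]
    (c a : ℝ) (s : E) :
    ∫ t in (0 : ℝ)..1, (1 - c * ‖(a * t) • s‖ ^ 2) = 1 - c * a ^ 2 * ‖s‖ ^ 2 / 3 := by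
  have h (t : ℝ) : 1 - c * ‖(a * t) • s‖ ^ 2 = 1 - c * a ^ 2 * ‖s‖ ^ 2 * t ^ 2 := by
    rw [norm_smul, mul_pow, Real.norm_eq_abs, sq_abs]
    ring
  simp_rw [h]
  rw [intervalIntegral.integral_sub (by simp)
    (Continuous.intervalIntegrable (by fun_prop) _ _), intervalIntegral.integral_const_mul,
    integral_pow]
  norm_num
  ring

/-- exact evaluation of the effective scattering kernel for the
quadratic covariance model C(χ) = 1 − c₂|χ|²:
e^{−α}(1/(2π))∫_{ℝ²} e^{−|s|²/2}[exp(α∫₀¹ C(a s s')ds') − 1] ds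
  = 1/(1 + 2αc₂a²/3) − e^{−α}. -/
theorem effective_scattering_kernel_quadratic_model
    (α c₂ a : ℝ) (hα : 0 < α) (hc₂ : 0 < c₂) (ha : 0 < a)
    (C : EuclideanSpace ℝ (Fin 2) → ℝ)
    (hC : ∀ χ : EuclideanSpace ℝ (Fin 2), C χ = 1 - c₂ * ‖χ‖^2) :
    Real.exp (-α) * (1 / (2 * Real.pi)) *
      (∫ s : EuclideanSpace ℝ (Fin 2), Real.exp (-‖s‖^2 / 2) *
        (Real.exp (α * ∫ s' in (0:ℝ)..1, C ((a * s') • s)) - 1))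
    = 1 / (1 + 2 * α * c₂ * a^2 / 3) - Real.exp (-α) := by
  have hb : 0 < 1 / 2 + α * c₂ * a ^ 2 / 3 := by positivity
  have hhalf : (0 : ℝ) < 1 / 2 := by norm_num
  have h (s : EuclideanSpace ℝ (Fin 2)) : Real.exp (-‖s‖^2 / 2) *
        (Real.exp (α * ∫ s' in (0:ℝ)..1, C ((a * s') • s)) - 1) =
      Real.exp α * Real.exp (-(1 / 2 + α * c₂ * a ^ 2 / 3) * ‖s‖ ^ 2)
        - Real.exp (-(1 / 2) * ‖s‖ ^ 2) := by
    simp_rw [hC]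
    rw [integral_quadratic_along_ray, mul_sub, mul_one, ← Real.exp_add, ← Real.exp_add]
    congr 2 <;> ring
  simp_rw [h]
  rw [integral_sub ((integrable_exp_neg_mul_sq_norm_plane hb).const_mul _)
    (integrable_exp_neg_mul_sq_norm_plane hhalf), integral_const_mul,
    integral_exp_neg_mul_sq_norm_plane hb, integral_exp_neg_mul_sq_norm_plane hhalf,
    Real.exp_neg]
  have hb' : 1 + 2 * α * c₂ * a ^ 2 / 3 = 2 * (1 / 2 + α * c₂ * a ^ 2 / 3) := by ring
  rw [hb']
  generalize 1 / 2 + α * c₂ * a ^ 2 / 3 = b at hb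
  field_simp
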